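/- Let A be an associative unital algebra over a field F, let p ∈ F satisfy p^s ≠ 1 for all 1 ≤ s ≤ t, and let X, Y ∈ A be commuting elements with Y invertible. Then for every integer c and decomposition c = c_X + c_Y one has the product formula (XY ; c choose t)_p = Σ_{s=0}^t p^{(s-c_Y)(s-t)} (X ; c_X choose t-s)_p · Y^{t-s} · (Y ; c_Y choose s)_p, where (M ; c choose n)_p := ∏_{r=1}^n (p^{c+1-r} M − 1)/(p^r − 1). -/

import Mathlib

/-- The `p`-binomial coefficient `(M ; c choose n)_p := ∏_{r=1}^n (p^{c+1-r} M − 1)/(p^r − 1)`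
in an `F`-algebra `A`, for a unit `p` of the field `F`. -/
noncomputable def pbinom {F A : Type*} [Field F] [Ring A] [Algebra F A]
    (p : Fˣ) (M : A) (c : ℤ) : ℕ → A
  | 0 => 1
  | n + 1 =>
      pbinom p M c n *
        (((p : F) ^ (n + 1) - 1)⁻¹ • (((p ^ (c - (n : ℤ)) : Fˣ) : F) • M - 1))

theorem pow_sub_one_smul_pbinom_succ {F A : Type*} [Field F] [Ring A] [Algebra F A] (p : Fˣ)
    (M : A) (c : ℤ) (n : ℕ) (hp : (p : F) ^ (n + 1) ≠ 1) :
    ((p : F) ^ (n + 1) - 1) • pbinom p M c (n + 1) =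
      pbinom p M c n * (((p ^ (c - (n : ℤ)) : Fˣ) : F) • M - 1) := by
  rw [pbinom, mul_smul_comm, smul_inv_smul₀ (sub_ne_zero.mpr hp)]

theorem Commute.pbinom_right {F A : Type*} [Field F] [Ring A] [Algebra F A] (p : Fˣ)
    {a M : A} (h : Commute a M) (c : ℤ) (n : ℕ) : Commute a (pbinom p M c n) := by
  induction n with
  | zero => exact Commute.one_right a
  | succ n ih =>
    exact ih.mul_right (((h.smul_right _).sub_right (Commute.one_right a)).smul_right _)

/-- The summand of the product formula, indexed by `m = t - s` and `n = s`. -/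
noncomputable def pbinomMulTerm {F A : Type*} [Field F] [Ring A] [Algebra F A] (p : Fˣ)
    (X Y : A) (cX cY : ℤ) (m n : ℕ) : A :=
  ((p ^ (((n : ℤ) - cY) * -(m : ℤ)) : Fˣ) : F) • (pbinom p X cX m * Y ^ m * pbinom p Y cY n)

theorem pbinomMulTerm_mul {F A : Type*} [Field F] [Ring A] [Algebra F A] (p : Fˣ)
    {X Y : A} (hcomm : Commute X Y) (cX cY : ℤ) (m n : ℕ)
    (hm : (p : F) ^ (m + 1) ≠ 1) (hn : (p : F) ^ (n + 1) ≠ 1) :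
    pbinomMulTerm p X Y cX cY m n *
        (((p ^ (cX + cY - ((m + n : ℕ) : ℤ)) : Fˣ) : F) • (X * Y) - 1) =
      ((p : F) ^ (m + 1) - 1) • pbinomMulTerm p X Y cX cY (m + 1) n +
        ((p : F) ^ (m + n + 1) - (p : F) ^ m) • pbinomMulTerm p X Y cX cY m (n + 1) := by
  have hX : ((p : F) ^ (m + 1) - 1) • pbinomMulTerm p X Y cX cY (m + 1) n =
      ((p ^ (((n : ℤ) - cY) * -((m + 1 : ℕ) : ℤ)) : Fˣ) : F) •
        (pbinom p X cX m * (((p ^ (cX - (m : ℤ)) : Fˣ) : F) • X - 1) * Y ^ (m + 1) *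
          pbinom p Y cY n) := by
    rw [pbinomMulTerm, smul_comm, ← pow_sub_one_smul_pbinom_succ p X cX m hm]
    simp only [smul_mul_assoc]
  have hY : ((p : F) ^ (m + n + 1) - (p : F) ^ m) • pbinomMulTerm p X Y cX cY m (n + 1) =
      ((p : F) ^ m * ((p ^ ((((n + 1 : ℕ) : ℤ) - cY) * -(m : ℤ)) : Fˣ) : F)) •
        (pbinom p X cX m * Y ^ m *
          (pbinom p Y cY n * (((p ^ (cY - (n : ℤ)) : Fˣ) : F) • Y - 1))) := by
    rw [pbinomMulTerm, ← pow_sub_one_smul_pbinom_succ p Y cY n hn, mul_smul_comm, smul_smul,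
      smul_smul]
    congr 1
    ring
  have hXD : pbinom p Y cY n * (X * Y) = X * Y * pbinom p Y cY n :=
    ((hcomm.pbinom_right p cY n).mul_left ((Commute.refl Y).pbinom_right p cY n)).symm.eq
  have hYD : pbinom p Y cY n * Y = Y * pbinom p Y cY n :=
    ((Commute.refl Y).pbinom_right p cY n).symm.eq
  have hYX : Y ^ m * (X * (Y * pbinom p Y cY n)) = X * (Y ^ m * (Y * pbinom p Y cY n)) := by
    rw [← mul_assoc, ← (hcomm.pow_right m).eq, mul_assoc]
  have hp0 : (p : F) ≠ 0 := p.ne_zero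
  have e₁ : (p : F) ^ (cX + cY - ((m : ℤ) + n)) * (p : F) ^ (((n : ℤ) - cY) * -(m : ℤ)) =
      (p : F) ^ (((n : ℤ) - cY) * -((m : ℤ) + 1)) * (p : F) ^ (cX - (m : ℤ)) := by
    rw [← zpow_add₀ hp0, ← zpow_add₀ hp0]
    congr 1
    ring
  have e₂ : (p : F) ^ m * (p : F) ^ (((n : ℤ) + 1 - cY) * -(m : ℤ)) =
      (p : F) ^ (((n : ℤ) - cY) * -(m : ℤ)) := by
    rw [← zpow_natCast, ← zpow_add₀ hp0]
    congr 1
    ring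
  have e₃ : (p : F) ^ (((n : ℤ) - cY) * -(m : ℤ)) * (p : F) ^ (cY - (n : ℤ)) =
      (p : F) ^ (((n : ℤ) - cY) * -((m : ℤ) + 1)) := by
    rw [← zpow_add₀ hp0]
    congr 1
    ring
  rw [hX, hY, pbinomMulTerm]
  push_cast [Units.val_zpow_eq_zpow_val]
  rw [e₂]
  generalize (p : F) ^ (((n : ℤ) - cY) * -(m : ℤ)) = a at e₁ e₃ ⊢
  generalize (p : F) ^ (((n : ℤ) - cY) * -((m : ℤ) + 1)) = b at e₁ e₃ ⊢
  generalize (p : F) ^ (cX + cY - ((m : ℤ) + n)) = u at e₁ ⊢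
  generalize (p : F) ^ (cX - (m : ℤ)) = v at e₁ ⊢
  generalize (p : F) ^ (cY - (n : ℤ)) = w at e₃ ⊢
  simp only [mul_sub, sub_mul, smul_sub, mul_smul_comm, smul_mul_assoc, smul_smul, mul_one,
    mul_assoc, hXD, hYD, hYX, pow_succ, e₁, e₃]
  abel

theorem pbinom_mul_eq_sum_antidiagonal {F A : Type*} [Field F] [Ring A] [Algebra F A] (p : Fˣ)
    (t : ℕ) (hp : ∀ s : ℕ, 1 ≤ s → s ≤ t → (p : F) ^ s ≠ 1)
    {X Y : A} (hcomm : Commute X Y) (cX cY : ℤ) :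
    pbinom p (X * Y) (cX + cY) t =
      ∑ ij ∈ Finset.HasAntidiagonal.antidiagonal t, pbinomMulTerm p X Y cX cY ij.1 ij.2 := by
  induction t with
  | zero => simp [pbinomMulTerm, pbinom]
  | succ t ih =>
    have hpt := hp (t + 1) (by omega) le_rfl
    apply (smul_right_injective A (sub_ne_zero.mpr hpt))
    dsimp only
    rw [pow_sub_one_smul_pbinom_succ p _ _ _ hpt, ih fun s h₁ h₂ => hp s h₁ (by omega),
      Finset.sum_mul]
    have hterm : ∀ ij ∈ Finset.HasAntidiagonal.antidiagonal t,
        pbinomMulTerm p X Y cX cY ij.1 ij.2 *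
            (((p ^ (cX + cY - (t : ℤ)) : Fˣ) : F) • (X * Y) - 1) =
          ((p : F) ^ (ij.1 + 1) - 1) • pbinomMulTerm p X Y cX cY (ij.1 + 1) ij.2 +
            ((p : F) ^ (t + 1) - (p : F) ^ ij.1) •
              pbinomMulTerm p X Y cX cY ij.1 (ij.2 + 1) := by
      rintro ⟨m, n⟩ h
      obtain rfl := Finset.HasAntidiagonal.mem_antidiagonal.mp h
      exact pbinomMulTerm_mul p hcomm cX cY m n (hp _ (by omega) (by omega))
        (hp _ (by omega) (by omega))
    have h₁ : ∑ ij ∈ Finset.HasAntidiagonal.antidiagonal (t + 1),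
        ((p : F) ^ ij.1 - 1) • pbinomMulTerm p X Y cX cY ij.1 ij.2 =
          ∑ ij ∈ Finset.HasAntidiagonal.antidiagonal t,
            ((p : F) ^ (ij.1 + 1) - 1) • pbinomMulTerm p X Y cX cY (ij.1 + 1) ij.2 := by
      simp [Finset.Nat.sum_antidiagonal_succ]
    have h₂ : ∑ ij ∈ Finset.HasAntidiagonal.antidiagonal (t + 1),
        ((p : F) ^ (t + 1) - (p : F) ^ ij.1) • pbinomMulTerm p X Y cX cY ij.1 ij.2 =
          ∑ ij ∈ Finset.HasAntidiagonal.antidiagonal t, ((p : F) ^ (t + 1) - (p : F) ^ ij.1) •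
            pbinomMulTerm p X Y cX cY ij.1 (ij.2 + 1) := by
      simp [Finset.Nat.sum_antidiagonal_succ']
    rw [Finset.sum_congr rfl hterm, Finset.sum_add_distrib, ← h₁, ← h₂, ← Finset.sum_add_distrib,
      Finset.smul_sum]
    refine Finset.sum_congr rfl fun ij _ => ?_
    rw [← add_smul]
    congr 1
    ring

/-- Product formula for `p`-binomial coefficients: if `X` and `Y` commute, `Y` is
invertible, and `c = c_X + c_Y`, then
`(XY ; c choose t)_p = ∑_{s=0}^t p^{(s-c_Y)(s-t)} (X ; c_X choose t-s)_p Y^{t-s} (Y ; c_Y choose s)_p`. -/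
theorem pbinom_mul {F A : Type*} [Field F] [Ring A] [Algebra F A] (p : Fˣ) (t : ℕ)
    (hp : ∀ s : ℕ, 1 ≤ s → s ≤ t → (p : F) ^ s ≠ 1)
    (X Y : A) (hcomm : X * Y = Y * X) (hY : IsUnit Y)
    (c cX cY : ℤ) (hc : cX + cY = c) :
    pbinom p (X * Y) c t =
      ∑ s ∈ Finset.range (t + 1),
        ((p ^ (((s : ℤ) - cY) * ((s : ℤ) - (t : ℤ))) : Fˣ) : F) •
          (pbinom p X cX (t - s) * Y ^ (t - s) * pbinom p Y cY s) := by
  subst hc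
  rw [pbinom_mul_eq_sum_antidiagonal p t hp hcomm cX cY,
    ← Finset.Nat.sum_antidiagonal_swap, Finset.Nat.sum_antidiagonal_eq_sum_range_succ_mk]
  refine Finset.sum_congr rfl fun s hs => ?_
  have hst : s ≤ t := Finset.mem_range_succ_iff.mp hs
  simp only [Prod.fst_swap, Prod.snd_swap, pbinomMulTerm, Nat.cast_sub hst, neg_sub]
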